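/- arXiv:math/0701017 — 2 statements merged into one kernel-verified Lean document; each statement's English description precedes it below -/
import Mathlib

section
/- Let L be a finite dimensional simple (right) Leibniz algebra over an algebraically closed field k of characteristic 0 such that the Lie factor L/L^ann is isomorphic, as a Lie algebra over k, to the three-dimensional simple Lie algebra sl_2(k). If dim L is even and dim L > 6, then, setting n := dim L - 4 (so n ≥ 4 is even), there exist α, β ∈ k and a basis {f, h, e, v_0, v_1, …, v_n} of L such that the bracket satisfies ⟨e,e⟩ = α v_{n/2-2}, ⟨f,f⟩ = β v_{n/2+2}, ⟨h,e⟩ = 2e - α v_{n/2-1}, ⟨e,h⟩ = -2e, ⟨h,f⟩ = -2f + (-4α/(n²+2n-8) - 2β) v_{n/2+1}, ⟨f,h⟩ = 2f, ⟨e,f⟩ = h, ⟨f,e⟩ = -h + (4α/(n²+2n-8) + n(n+2)β/4) v_{n/2}, ⟨v_k, h⟩ = -(n-2k) v_k, ⟨v_k, f⟩ = -v_{k+1}, ⟨v_k, e⟩ = -k(n-k+1) v_{k-1} for k = 0,…,n (with v_j := 0 for j ∉ {0,…,n}), and all other brackets of basis elements equal to 0; that is, L is isomorphic as a Leibniz algebra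 to sl_{2,n}^{α,β}. -/
section

open Module

attribute [local instance] LieRing.ofAssociativeRing

namespace IsSl2Triple

variable {k : Type*} [Field k]

/-- The special linear Lie algebra of rank one has a basis which is an `sl₂` triple. -/
theorem exists_basis_sl [CharZero k] :
    ∃ h e f : LieAlgebra.SpecialLinear.sl (Fin 2) k, IsSl2Triple h e f ∧
      LinearIndependent k ![f, h, e] ∧
      ∀ x, ∃ a b c : k, x = a • f + b • h + c • e := by
  have ht : ∀ A : Matrix (Fin 2) (Fin 2) k, A.trace = 0 →
      A ∈ LieAlgebra.SpecialLinear.sl (Fin 2) k := fun A hA => hA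
  refine ⟨⟨!![1, 0; 0, -1], ht _ (by simp [Matrix.trace_fin_two])⟩,
    ⟨!![0, 1; 0, 0], ht _ (by simp [Matrix.trace_fin_two])⟩,
    ⟨!![0, 0; 1, 0], ht _ (by simp [Matrix.trace_fin_two])⟩, ⟨?_, ?_, ?_, ?_⟩, ?_, ?_⟩
  · intro h
    have := congrArg (fun A => A.val 0 0) h
    simp at this
  · ext i j
    fin_cases i <;> fin_cases j <;> simp [LieRing.of_associative_ring_bracket]
  · ext i j
    fin_cases i <;> fin_cases j <;>
      simp [LieRing.of_associative_ring_bracket, one_add_one_eq_two]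
  · ext i j
    fin_cases i <;> fin_cases j <;> simp [LieRing.of_associative_ring_bracket]
    ring
  · rw [Fintype.linearIndependent_iff]
    intro g hg
    have h0 := congrArg (fun A => A.val 1 0) hg
    have h1 := congrArg (fun A => A.val 0 0) hg
    have h2 := congrArg (fun A => A.val 0 1) hg
    simp [Fin.sum_univ_three] at h0 h1 h2
    intro i
    fin_cases i <;> assumption
  · rintro ⟨A, hA⟩
    have hA' : A.trace = 0 := hA
    rw [Matrix.trace_fin_two] at hA'
    refine ⟨A 1 0, A 0 0, A 0 1, ?_⟩
    ext i j
    fin_cases i <;> fin_cases j <;> simp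
    linear_combination hA'

variable {M : Type*} [AddCommGroup M] [Module k M]

/-- A nonzero finite-dimensional subspace stable under `h` and `e` contains a primitive vector. -/
theorem exists_mem_hasPrimitiveVectorWith [IsAlgClosed k] [CharZero k] [FiniteDimensional k M]
    {h e f : End k M} (t : IsSl2Triple h e f) {W : Submodule k M} (hW : W ≠ ⊥)
    (hh : ∀ x ∈ W, h x ∈ W) (he : ∀ x ∈ W, e x ∈ W) :
    ∃ m ∈ W, ∃ μ : k, HasPrimitiveVectorWith t m μ := by
  have : Nontrivial W := Submodule.nontrivial_iff_ne_bot.mpr hW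
  by_contra! hno
  have hstep : ∀ μ : k, Module.End.HasEigenvalue (h.restrict hh) μ →
      Module.End.HasEigenvalue (h.restrict hh) (μ + 2) := by
    intro μ hμ
    obtain ⟨⟨x, hxW⟩, hx⟩ := hμ.exists_hasEigenvector
    have hhx : h x = μ • x := congrArg Subtype.val hx.apply_eq_smul
    have hx0 : x ≠ 0 := fun h0 => hx.2 (by simpa using h0)
    have hex : e x ≠ 0 := fun h0 => hno x hxW μ ⟨hx0, hhx, h0⟩
    refine Module.End.hasEigenvalue_of_hasEigenvector (x := ⟨e x, he x hxW⟩)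
      ⟨Module.End.mem_eigenspace_iff.mpr (Subtype.ext ?_), fun h0 => hex (congrArg Subtype.val h0)⟩
    have := congrArg (fun T : End k M => T x) (t.lie_h_e_smul k)
    simp only [LieRing.of_associative_ring_bracket, LinearMap.sub_apply, Module.End.mul_apply,
      LinearMap.smul_apply, hhx, map_smul] at this
    change h (e x) = (μ + 2) • e x
    rw [add_smul, ← this, add_sub_cancel]
  obtain ⟨μ, hμ⟩ := Module.End.exists_eigenvalue (h.restrict hh)
  have hall : ∀ j : ℕ, Module.End.HasEigenvalue (h.restrict hh) (μ + 2 * j) := by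
    intro j
    induction j with
    | zero => simpa using hμ
    | succ j ih => convert hstep _ ih using 1; push_cast; ring
  refine Set.infinite_of_injective_forall_mem (f := fun j : ℕ => μ + 2 * (j : k)) ?_ hall
    (Module.End.finite_hasEigenvalue (h.restrict hh))
  intro i j hij
  simpa using hij

/-- The string of vectors generated by a primitive vector of weight `n`. -/
theorem HasPrimitiveVectorWith.exists_string [CharZero k] [FiniteDimensional k M]
    {h e f : End k M} {t : IsSl2Triple h e f} {m : M} {n : ℕ}
    (P : HasPrimitiveVectorWith t m (n : k)) :
    (∀ j, n < j → (f ^ j) m = 0) ∧ LinearIndependent k (fun i : Fin (n + 1) => (f ^ (i : ℕ)) m) ∧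
    (∀ j : ℕ, h ((f ^ j) m) = ((n : k) - 2 * j) • (f ^ j) m) ∧
    ∀ j : ℕ, e ((f ^ j) m) = ((j : k) * (n - j + 1)) • (f ^ (j - 1)) m := by
  have hf : LieModule.toEnd k (End k M) M f = f := rfl
  have hh : ∀ j : ℕ, h ((f ^ j) m) = ((n : k) - 2 * j) • (f ^ j) m := fun j => by
    simpa [hf] using P.lie_h_pow_toEnd_f j
  have he : ∀ j : ℕ, e ((f ^ j) m) = ((j : k) * (n - j + 1)) • (f ^ (j - 1)) m := by
    rintro (_ | j)
    · simpa using P.lie_e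
    · have := P.lie_e_pow_succ_toEnd_f j
      simp only [hf, Module.End.lie_apply] at this
      simp only [this, Nat.cast_add, Nat.cast_one, Nat.add_sub_cancel]
      congr 1
      ring
  have h0 : (f ^ (n + 1)) m = 0 := by
    simpa [hf] using P.pow_toEnd_f_eq_zero_of_eq_nat rfl
  refine ⟨fun j hj => ?_, ?_, hh, he⟩
  · obtain ⟨i, rfl⟩ := Nat.exists_eq_add_of_lt hj
    rw [show n + i + 1 = i + (n + 1) by ring, pow_add, Module.End.mul_apply, h0, map_zero]
  · refine Module.End.eigenvectors_linearIndependent' h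
      (fun i : Fin (n + 1) => (n : k) - 2 * (i : ℕ))
      (fun i j hij => ?_) _ fun i => ⟨Module.End.mem_eigenspace_iff.mpr (hh i), ?_⟩
    · simpa [Fin.ext_iff] using hij
    · simpa [hf] using P.pow_toEnd_f_ne_zero_of_eq_nat rfl (Nat.lt_succ_iff.mp i.2)

/-- The Casimir element of an `sl₂` triple of endomorphisms, up to scaling. -/
def casimir (h e f : End k M) : End k M := h * h + (2 : k) • h + (4 : k) • (f * e)

theorem casimir_comm {h e f : End k M} (t : IsSl2Triple h e f) :
    Commute (casimir h e f) h ∧ Commute (casimir h e f) e ∧ Commute (casimir h e f) f := by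
  have hef : e * f = f * e + h := by
    rw [← sub_eq_iff_eq_add', ← LieRing.of_associative_ring_bracket, t.lie_e_f]
  have hhe : h * e = e * h + (2 : k) • e := by
    rw [← sub_eq_iff_eq_add', ← LieRing.of_associative_ring_bracket, t.lie_h_e_smul k]
  have hhf : h * f = f * h - (2 : k) • f := by
    rw [sub_eq_add_neg, ← sub_eq_iff_eq_add', ← LieRing.of_associative_ring_bracket,
      t.lie_lie_smul_f k]
  have hef' (x : End k M) : e * (f * x) = f * (e * x) + h * x := by
    rw [← mul_assoc, hef, add_mul, mul_assoc]
  have hhe' (x : End k M) : h * (e * x) = e * (h * x) + (2 : k) • (e * x) := by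
    rw [← mul_assoc, hhe, add_mul, mul_assoc, smul_mul_assoc]
  have hhf' (x : End k M) : h * (f * x) = f * (h * x) - (2 : k) • (f * x) := by
    rw [← mul_assoc, hhf, sub_mul, mul_assoc, smul_mul_assoc]
  refine ⟨?_, ?_, ?_⟩ <;> rw [Commute, SemiconjBy, casimir] <;>
    simp only [add_mul, mul_add, smul_mul_assoc, mul_smul_comm, mul_assoc, hef, hhe, hhf, hef',
      hhe', hhf', mul_sub, smul_add, smul_sub] <;> module

end IsSl2Triple

namespace RightLeibniz

variable {k L : Type*} [Field k] [AddCommGroup L] [Module k L] {br : L →ₗ[k] L →ₗ[k] L}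

/-- The negative of right multiplication, which is a left representation of the Lie factor. -/
def rightAction (br : L →ₗ[k] L →ₗ[k] L) : L →ₗ[k] End k L := -br.flip

@[simp]
theorem rightAction_apply (x y : L) : rightAction br y x = -br x y := rfl

theorem br_eq_zero_of_mem_span
    (hleib : ∀ x y z : L, br (br x y) z = br x (br y z) + br (br x z) y)
    {a : L} (ha : a ∈ Submodule.span k {z : L | ∃ x : L, z = br x x})
    (x : L) : br x a = 0 := by
  induction ha using Submodule.span_induction with
  | mem z hz => obtain ⟨y, rfl⟩ := hz; simpa using hleib x y y
  | zero => simp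
  | add a b _ _ ha hb => simp [ha, hb]
  | smul c a _ ha => simp [ha]

theorem lie_rightAction
    (hleib : ∀ x y z : L, br (br x y) z = br x (br y z) + br (br x z) y)
    (y z : L) :
    ⁅rightAction br y, rightAction br z⁆ = rightAction br (br y z) := by
  ext x
  simp only [LieRing.of_associative_ring_bracket, LinearMap.sub_apply, End.mul_apply,
    rightAction_apply, map_neg, neg_neg, hleib x y z]
  abel

theorem map_casimir_rightAction {g : Type*} [LieRing g] [LieAlgebra k g] {π : L →ₗ[k] g}
    (hπbr : ∀ x y : L, π (br x y) = ⁅π x, π y⁆) {h e f : L} (t : IsSl2Triple (π h) (π e) (π f))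
    (hg : ∀ x, ∃ a b c : k, x = a • π f + b • π h + c • π e) (x : L) :
    π (IsSl2Triple.casimir (rightAction br h) (rightAction br e) (rightAction br f) x) =
      (8 : k) • π x := by
  have hef := t.lie_e_f
  have hhe := t.lie_h_e_smul k
  have hhf := t.lie_lie_smul_f k
  have hfe : ⁅π f, π e⁆ = -π h := by rw [← lie_skew, hef]
  have heh : ⁅π e, π h⁆ = -((2 : k) • π e) := by rw [← lie_skew, hhe]
  have hfh : ⁅π f, π h⁆ = (2 : k) • π f := by rw [← lie_skew, hhf, neg_neg]
  obtain ⟨a, b, c, hx⟩ := hg (π x)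
  simp only [IsSl2Triple.casimir, LinearMap.add_apply, LinearMap.smul_apply, End.mul_apply,
    rightAction_apply, map_add, map_smul, map_neg, hπbr, neg_neg, hx,
    add_lie, smul_lie, neg_lie, hef, hhe, hhf, hfe, heh, hfh, lie_self, zero_lie, smul_zero,
    smul_neg]
  module

/-- A simple Leibniz algebra with Lie factor `sl₂` and annihilator of dimension different from
three is a split extension of `sl₂` by an irreducible module. -/
theorem exists_split_basis [IsAlgClosed k] [CharZero k] [FiniteDimensional k L]
    (hleib : ∀ x y z : L, br (br x y) z = br x (br y z) + br (br x z) y)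
    {ann : Submodule k L} (hann : ann = Submodule.span k {z : L | ∃ x : L, z = br x x})
    (hann₀ : ann ≠ ⊥)
    (hsimple : ∀ I : Submodule k L, (∀ a ∈ I, ∀ x : L, br a x ∈ I ∧ br x a ∈ I) →
      I = ⊥ ∨ I = ann ∨ I = ⊤)
    {π : L →ₗ[k] LieAlgebra.SpecialLinear.sl (Fin 2) k} (hπsurj : Function.Surjective π)
    (hπbr : ∀ x y : L, π (br x y) = ⁅π x, π y⁆) (hπker : LinearMap.ker π = ann)
    (hdim : 6 < finrank k L) {n : ℕ} (hn : n = finrank k L - 4) :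
    ∃ (F H E : L) (v : ℕ → L), (∀ j : ℕ, v j ∈ ann) ∧ (∀ j : ℕ, n < j → v j = 0) ∧
      LinearIndependent k (Sum.elim ![F, H, E] (fun i : Fin (n + 1) => v i)) ∧
      Submodule.span k ({F, H, E} ∪ v '' {j : ℕ | j ≤ n}) = ⊤ ∧
      br E E = 0 ∧ br F F = 0 ∧ br H H = 0 ∧
      br H E = (2 : k) • E ∧ br E H = (-2 : k) • E ∧
      br H F = (-2 : k) • F ∧ br F H = (2 : k) • F ∧
      br E F = H ∧ br F E = -H ∧
      (∀ j : ℕ, br (v j) H = (-((n : k) - 2 * (j : k))) • v j) ∧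
      (∀ j : ℕ, br (v j) F = -v (j + 1)) ∧
      ∀ j : ℕ, br (v j) E = (-((j : k) * ((n : k) - (j : k) + 1))) • v (j - 1) := by
  have hbr0 : ∀ a ∈ ann, ∀ x, br x a = 0 := fun a ha x =>
    br_eq_zero_of_mem_span hleib (hann ▸ ha) x
  have hact : ∀ {x y : L}, π x = π y → rightAction br x = rightAction br y := by
    intro x y hxy
    ext z
    have hmem : x - y ∈ ann := by rw [← hπker, LinearMap.mem_ker, map_sub, hxy, sub_self]
    have := hbr0 _ hmem z
    rw [map_sub, sub_eq_zero] at this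
    simp [this]
  have hann_br : ∀ a ∈ ann, ∀ x, br a x ∈ ann := by
    intro a ha x
    rw [← hπker, LinearMap.mem_ker] at ha ⊢
    rw [hπbr, ha, zero_lie]
  obtain ⟨h', e', f', t', hli, hspan⟩ := IsSl2Triple.exists_basis_sl (k := k)
  obtain ⟨h, rfl⟩ := hπsurj h'
  obtain ⟨e, rfl⟩ := hπsurj e'
  obtain ⟨f, rfl⟩ := hπsurj f'
  have he0 : π e ≠ 0 := t'.e_ne_zero
  have t : IsSl2Triple (rightAction br h) (rightAction br e) (rightAction br f) := by
    refine ⟨fun h0 => ?_, ?_, ?_, ?_⟩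
    · have h1 : π (rightAction br h e) = (2 : k) • π e := by
        rw [rightAction_apply, map_neg, hπbr, lie_skew, t'.lie_h_e_smul k]
      rw [h0, LinearMap.zero_apply, map_zero, eq_comm] at h1
      exact (smul_ne_zero two_ne_zero he0) h1
    · rw [lie_rightAction hleib]
      exact hact (by rw [hπbr, t'.lie_e_f])
    · rw [lie_rightAction hleib, ← map_nsmul]
      exact hact (by rw [hπbr, t'.lie_h_e_nsmul, map_nsmul])
    · rw [lie_rightAction hleib, ← map_nsmul, ← map_neg]
      exact hact (by rw [hπbr, t'.lie_h_f_nsmul, map_neg, map_nsmul])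
  have hstab : ∀ y, ∀ x ∈ ann, rightAction br y x ∈ ann := fun y x hx =>
    neg_mem (hann_br x hx y)
  obtain ⟨m, hm, μ, P⟩ := t.exists_mem_hasPrimitiveVectorWith hann₀ (hstab h) (hstab e)
  obtain ⟨N, rfl⟩ := P.exists_nat
  obtain ⟨hv0, hvli, hvh, hve⟩ := P.exists_string
  set v : ℕ → L := fun j => (rightAction br f ^ j) m with hv
  have hvf : ∀ j, rightAction br f (v j) = v (j + 1) := fun j => by
    simp only [hv, pow_succ', End.mul_apply]
  have hvann : ∀ j, v j ∈ ann := by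
    intro j
    induction j with
    | zero => simpa [hv] using hm
    | succ j ih => rw [← hvf]; exact hstab f _ ih
  have hvspan : Submodule.span k (Set.range v) = ann := by
    have hle : Submodule.span k (Set.range v) ≤ ann :=
      Submodule.span_le.mpr (Set.range_subset_iff.mpr hvann)
    have hvmem : ∀ j, v j ∈ Submodule.span k (Set.range v) := fun j =>
      Submodule.subset_span ⟨j, rfl⟩
    have hideal : ∀ a ∈ Submodule.span k (Set.range v), ∀ x : L,
        br a x ∈ Submodule.span k (Set.range v) ∧ br x a ∈ Submodule.span k (Set.range v) := by
      refine fun a ha x => ⟨?_, by rw [hbr0 a (hle ha) x]; exact zero_mem _⟩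
      rw [← neg_mem_iff, ← rightAction_apply]
      obtain ⟨α, β, γ, hx⟩ := hspan (π x)
      rw [hact (show π x = π (α • f + β • h + γ • e) by simpa using hx)]
      induction ha using Submodule.span_induction with
      | mem z hz =>
        obtain ⟨j, rfl⟩ := hz
        simp only [map_add, map_smul, LinearMap.add_apply, LinearMap.smul_apply]
        rw [hvf, show v j = (rightAction br f ^ j) m from rfl, hvh, hve]
        exact add_mem (add_mem (Submodule.smul_mem _ _ (hvmem _))
          (Submodule.smul_mem _ _ (Submodule.smul_mem _ _ (hvmem j))))
          (Submodule.smul_mem _ _ (Submodule.smul_mem _ _ (hvmem (j - 1))))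
      | zero => simp
      | add a b _ _ ha hb => rw [map_add]; exact add_mem ha hb
      | smul c a _ ha => rw [map_smul]; exact Submodule.smul_mem _ _ ha
    rcases hsimple _ hideal with h0 | h0 | h0
    · exact absurd (h0 ▸ hvmem 0) (by simpa [hv] using P.ne_zero)
    · exact h0
    · have : e ∈ LinearMap.ker π := hπker ▸ hle (h0 ▸ Submodule.mem_top)
      exact absurd this he0
  have hvspan' : Submodule.span k (Set.range fun i : Fin (N + 1) => v i) = ann := by
    refine le_antisymm (Submodule.span_le.mpr (Set.range_subset_iff.mpr fun i => hvann i)) ?_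
    rw [← hvspan, Submodule.span_le, Set.range_subset_iff]
    intro j
    by_cases hj : N < j
    · rw [show v j = 0 from hv0 j hj]
      exact zero_mem _
    · exact Submodule.subset_span ⟨⟨j, by lia⟩, rfl⟩
  have hsl : finrank k (LieAlgebra.SpecialLinear.sl (Fin 2) k) = 3 := by
    have hb := finrank_eq_card_basis (Basis.mk hli fun x _ => ?_)
    · simpa using hb
    · obtain ⟨a, b, c, rfl⟩ := hspan x
      have hi : ∀ i, ![π f, π h, π e] i ∈ Submodule.span k (Set.range ![π f, π h, π e]) :=
        fun i => Submodule.subset_span ⟨i, rfl⟩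
      exact add_mem (add_mem (Submodule.smul_mem _ _ (hi 0)) (Submodule.smul_mem _ _ (hi 1)))
        (Submodule.smul_mem _ _ (hi 2))
  have hfin : finrank k L = 3 + (N + 1) := by
    rw [← LinearMap.finrank_range_add_finrank_ker π, LinearMap.range_eq_top.mpr hπsurj,
      finrank_top, hsl, hπker, ← hvspan', finrank_span_eq_card hvli, Fintype.card_fin]
  obtain rfl : n = N := by lia
  set C := IsSl2Triple.casimir (rightAction br h) (rightAction br e) (rightAction br f) with hC
  obtain ⟨hCh, hCe, hCf⟩ := IsSl2Triple.casimir_comm t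
  rw [← hC] at hCh hCe hCf
  have hCann : ∀ x ∈ ann, C x = ((n : k) * (n + 2)) • x := by
    intro x hx
    rw [← hvspan] at hx
    induction hx using Submodule.span_induction with
    | mem z hz =>
      obtain ⟨j, rfl⟩ := hz
      have hfe : (j : k) • v (j - 1 + 1) = (j : k) • v j := by
        rcases j with _ | j <;> simp
      have h1 : rightAction br f (rightAction br e (v j)) = ((n : k) - j + 1) • (j : k) • v j := by
        rw [show rightAction br e (v j) = _ from hve j, map_smul, ← hfe, ← hvf, smul_smul, mul_comm]
      have h2 : rightAction br h (v j) = ((n : k) - 2 * j) • v j := hvh j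
      simp only [hC, IsSl2Triple.casimir, LinearMap.add_apply, LinearMap.smul_apply, End.mul_apply,
        h1, h2, map_smul]
      module
    | zero => simp
    | add a b _ _ ha hb => rw [map_add, ha, hb, smul_add]
    | smul c a _ ha => rw [map_smul, ha, smul_comm]
  have hCL : ∀ x, π (C x) = (8 : k) • π x := map_casimir_rightAction hπbr t' hspan
  have hc : (8 : k) - n * (n + 2) ≠ 0 := by
    rw [sub_ne_zero]
    have : 8 ≠ n * (n + 2) := by
      have : 3 ≤ n := by lia
      nlinarith
    exact_mod_cast this
  have hinj : ∀ {x y : L}, C x = (8 : k) • x → C y = (8 : k) • y → π x = π y → x = y := by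
    intro x y hx hy hxy
    have hmem : x - y ∈ ann := by rw [← hπker, LinearMap.mem_ker, map_sub, hxy, sub_self]
    have h1 := hCann _ hmem
    rw [map_sub, hx, hy, ← smul_sub, ← sub_eq_zero, ← sub_smul] at h1
    exact sub_eq_zero.mp ((smul_eq_zero.mp h1).resolve_left hc)
  have hlift : ∀ x, ∃ y, C y = (8 : k) • y ∧ π y = π x := by
    intro x
    refine ⟨((8 : k) - n * (n + 2))⁻¹ • (C x - ((n : k) * (n + 2)) • x), ?_, ?_⟩
    · have hmem : C x - (8 : k) • x ∈ ann := by
        rw [← hπker, LinearMap.mem_ker, map_sub, hCL, map_smul, sub_self]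
      have h1 := hCann _ hmem
      rw [map_sub, map_smul, sub_eq_iff_eq_add] at h1
      rw [map_smul, smul_comm (8 : k), map_sub, map_smul, h1]
      congr 1
      module
    · rw [map_smul, map_sub, hCL, map_smul, ← sub_smul, smul_smul, inv_mul_cancel₀ hc, one_smul]
  obtain ⟨H, hH, hHπ⟩ := hlift h
  obtain ⟨E, hE, hEπ⟩ := hlift e
  obtain ⟨F, hF, hFπ⟩ := hlift f
  have hSbr : ∀ {T : End k L} {x : L}, Commute C T → C x = (8 : k) • x →
      C (T x) = (8 : k) • T x := by
    intro T x hT hx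
    rw [← End.mul_apply, hT.eq, End.mul_apply, hx, map_smul]
  have hSH : ∀ {x : L}, C x = (8 : k) • x → C (br x H) = (8 : k) • br x H := fun hx => by
    rw [← neg_neg (br _ H), ← rightAction_apply, hact hHπ, map_neg, hSbr hCh hx, smul_neg]
  have hSE : ∀ {x : L}, C x = (8 : k) • x → C (br x E) = (8 : k) • br x E := fun hx => by
    rw [← neg_neg (br _ E), ← rightAction_apply, hact hEπ, map_neg, hSbr hCe hx, smul_neg]
  have hSF : ∀ {x : L}, C x = (8 : k) • x → C (br x F) = (8 : k) • br x F := fun hx => by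
    rw [← neg_neg (br _ F), ← rightAction_apply, hact hFπ, map_neg, hSbr hCf hx, smul_neg]
  have hSsmul : ∀ (c : k) {x : L}, C x = (8 : k) • x → C (c • x) = (8 : k) • c • x :=
    fun c x hx => by rw [map_smul, hx, smul_comm]
  have hS0 : C 0 = (8 : k) • (0 : L) := by simp
  have hspanL : Submodule.span k ({F, H, E} ∪ v '' {j : ℕ | j ≤ n}) = ⊤ := by
    rw [eq_top_iff]
    intro x _
    obtain ⟨a, b, c, hx⟩ := hspan (π x)
    have hmem : x - (a • F + b • H + c • E) ∈ ann := by
      rw [← hπker, LinearMap.mem_ker, map_sub, hx]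
      simp [hFπ, hHπ, hEπ]
    rw [← hvspan'] at hmem
    have hle : Submodule.span k (Set.range fun i : Fin (n + 1) => v i) ≤
        Submodule.span k ({F, H, E} ∪ v '' {j : ℕ | j ≤ n}) := by
      refine Submodule.span_mono ?_
      rintro _ ⟨i, rfl⟩
      exact Or.inr ⟨i, Nat.lt_succ_iff.mp i.2, rfl⟩
    rw [← sub_add_cancel x (a • F + b • H + c • E)]
    exact add_mem (hle hmem) (add_mem (add_mem
      (Submodule.smul_mem _ _ (Submodule.subset_span (by simp)))
      (Submodule.smul_mem _ _ (Submodule.subset_span (by simp))))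
      (Submodule.smul_mem _ _ (Submodule.subset_span (by simp))))
  have hli' : LinearIndependent k (Sum.elim ![F, H, E] (fun i : Fin (n + 1) => v i)) := by
    refine linearIndependent_of_top_le_span_of_card_eq_finrank ?_ (by simp [hfin])
    rw [← hspanL]
    refine Submodule.span_mono ?_
    rintro x ((rfl | rfl | rfl) | ⟨j, hj, rfl⟩)
    · exact ⟨Sum.inl 0, rfl⟩
    · exact ⟨Sum.inl 1, rfl⟩
    · exact ⟨Sum.inl 2, rfl⟩
    · exact ⟨Sum.inr ⟨j, Nat.lt_succ_iff.mpr hj⟩, rfl⟩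
  have hπhe := t'.lie_h_e_smul k
  have hπhf := t'.lie_lie_smul_f k
  refine ⟨F, H, E, v, hvann, hv0, hli', hspanL,
    hinj (hSE hE) hS0 ?_, hinj (hSF hF) hS0 ?_, hinj (hSH hH) hS0 ?_,
    hinj (hSE hH) (hSsmul _ hE) ?_, hinj (hSH hE) (hSsmul _ hE) ?_,
    hinj (hSF hH) (hSsmul _ hF) ?_, hinj (hSH hF) (hSsmul _ hF) ?_,
    hinj (hSF hE) hH ?_, hinj (hSE hF) (by simp [hH]) ?_, fun j => ?_, fun j => ?_, fun j => ?_⟩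
  · rw [hπbr, lie_self, map_zero]
  · rw [hπbr, lie_self, map_zero]
  · rw [hπbr, lie_self, map_zero]
  · rw [hπbr, map_smul, hHπ, hEπ, hπhe]
  · rw [hπbr, map_smul, hHπ, hEπ, ← lie_skew, hπhe, neg_smul]
  · rw [hπbr, map_smul, hHπ, hFπ, hπhf, neg_smul]
  · rw [hπbr, map_smul, hHπ, hFπ, ← lie_skew, hπhf, neg_neg]
  · rw [hπbr, hEπ, hFπ, hHπ, t'.lie_e_f]
  · rw [hπbr, map_neg, hEπ, hFπ, hHπ, ← lie_skew, t'.lie_e_f]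
  · rw [← neg_neg (br (v j) H), ← rightAction_apply, hact hHπ, neg_smul]
    exact congrArg _ (hvh j)
  · rw [← neg_neg (br (v j) F), ← rightAction_apply, hact hFπ, hvf]
  · rw [← neg_neg (br (v j) E), ← rightAction_apply, hact hEπ, neg_smul]
    exact congrArg _ (hve j)

end RightLeibniz

end


/-- Let `L` be a finite dimensional simple (right) Leibniz algebra over an
algebraically closed field `k` of characteristic `0` whose Lie factor `L/L^ann` is isomorphic
to `sl₂(k)`.  If `dim L` is even and `dim L > 6` then, with `n := dim L - 4` (so `n ≥ 4` is
even), there are `α, β ∈ k` and a basis `{f, h, e, v₀, …, v_n}` of `L` whose bracket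
satisfies the multiplication table of `sl_{2,n}^{α,β}` (with `v_j := 0` for `j ∉ {0,…,n}`
and all unlisted brackets of basis vectors equal to `0`); that is, `L` is isomorphic as a
Leibniz algebra to `sl_{2,n}^{α,β}`. -/
theorem simple_leibniz_sl2_even_dim_classification
    (k : Type*) [Field k] [IsAlgClosed k] [CharZero k]
    (L : Type*) [AddCommGroup L] [Module k L] [FiniteDimensional k L]
    (br : L →ₗ[k] L →ₗ[k] L)
    (hleib : ∀ x y z : L, br (br x y) z = br x (br y z) + br (br x z) y)
    (ann : Submodule k L)
    (hann : ann = Submodule.span k {z : L | ∃ x : L, z = br x x})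
    -- `L` is simple:
    (hsimple₁ : ∃ a ∈ ann, ∃ x : L, br a x ≠ 0)
    (hsimple₂ : ∀ I : Submodule k L, (∀ a ∈ I, ∀ x : L, br a x ∈ I ∧ br x a ∈ I) →
      I = ⊥ ∨ I = ann ∨ I = ⊤)
    -- the Lie factor `L/L^ann` is isomorphic to `sl₂(k)`:
    (π : L →ₗ[k] (LieAlgebra.SpecialLinear.sl (Fin 2) k))
    (hπsurj : Function.Surjective π)
    (hπbr : ∀ x y : L, π (br x y) = ⁅π x, π y⁆)
    (hπker : LinearMap.ker π = ann)
    (heven : Even (Module.finrank k L)) (hdim : 6 < Module.finrank k L)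
    (n : ℕ) (hn : n = Module.finrank k L - 4) :
    ∃ (α β : k) (F H E : L) (v : ℕ → L),
      -- `v_j = 0` for `j ∉ {0, …, n}`:
      (∀ j : ℕ, n < j → v j = 0) ∧
      -- `{f, h, e, v₀, …, v_n}` is a basis of `L`:
      LinearIndependent k (Sum.elim ![F, H, E] (fun i : Fin (n + 1) => v i)) ∧
      Submodule.span k ({F, H, E} ∪ v '' {j : ℕ | j ≤ n}) = ⊤ ∧
      -- the multiplication table of `sl_{2,n}^{α,β}`:
      br E E = α • v (n / 2 - 2) ∧
      br F F = β • v (n / 2 + 2) ∧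
      br H E = (2 : k) • E - α • v (n / 2 - 1) ∧
      br E H = (-2 : k) • E ∧
      br H F = (-2 : k) • F +
        ((-4 * α) / ((n : k) ^ 2 + 2 * (n : k) - 8) - 2 * β) • v (n / 2 + 1) ∧
      br F H = (2 : k) • F ∧
      br E F = H ∧
      br F E = -H +
        ((4 * α) / ((n : k) ^ 2 + 2 * (n : k) - 8) + (n : k) * ((n : k) + 2) / 4 * β) •
          v (n / 2) ∧
      (∀ j : ℕ, j ≤ n → br (v j) H = (-((n : k) - 2 * (j : k))) • v j) ∧
      (∀ j : ℕ, j ≤ n → br (v j) F = -v (j + 1)) ∧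
      (∀ j : ℕ, j ≤ n → br (v j) E = (-((j : k) * ((n : k) - (j : k) + 1))) • v (j - 1)) ∧
      -- all other brackets of basis elements are zero:
      br H H = 0 ∧
      (∀ j : ℕ, j ≤ n → br F (v j) = 0) ∧
      (∀ j : ℕ, j ≤ n → br H (v j) = 0) ∧
      (∀ j : ℕ, j ≤ n → br E (v j) = 0) ∧
      (∀ i j : ℕ, i ≤ n → j ≤ n → br (v i) (v j) = 0) := by
  have hann₀ : ann ≠ ⊥ := by
    rintro rfl
    obtain ⟨a, ha, x, hx⟩ := hsimple₁
    rw [Submodule.mem_bot] at ha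
    exact hx (by simp [ha])
  obtain ⟨F, H, E, v, hvann, hv0, hli, hspan, hEE, hFF, hHH, hHE, hEH, hHF, hFH, hEF, hFE,
    hvH, hvF, hvE⟩ := RightLeibniz.exists_split_basis hleib hann hann₀ hsimple₂ hπsurj hπbr hπker
      hdim hn
  have hbr0 : ∀ x j, br x (v j) = 0 := fun x j =>
    RightLeibniz.br_eq_zero_of_mem_span hleib (hann ▸ hvann j) x
  refine ⟨0, 0, F, H, E, v, hv0, hli, hspan, ?_, ?_, ?_, hEH, ?_, hFH, hEF, ?_, fun j _ => hvH j,
    fun j _ => hvF j, fun j _ => hvE j, hHH, fun j _ => hbr0 F j, fun j _ => hbr0 H j,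
    fun j _ => hbr0 E j, fun i j _ _ => hbr0 (v i) j⟩
  · simpa using hEE
  · simpa using hFF
  · simpa using hHE
  · simpa using hHF
  · simpa using hFE
end

section
/- Let L be a finite dimensional simple (right) Leibniz algebra over an algebraically closed field k of characteristic 0 such that the Lie factor L/L^ann is isomorphic, as a Lie algebra over k, to the three-dimensional simple Lie algebra sl_2(k). Then dim L ≥ 5; moreover, if dim L is even then dim L ≥ 6. -/
open LieAlgebra.SpecialLinear in
/-- Every element of `sl₂(k)` is a sum of two brackets when `2` is invertible. -/
theorem sl_two_eq_lie_add_lie {k : Type*} [Field k] [NeZero (2 : k)] (A : sl (Fin 2) k) :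
    ∃ B C D E : sl (Fin 2) k, A = ⁅B, C⁆ + ⁅D, E⁆ := by
  have mem {M : Matrix (Fin 2) (Fin 2) k} (h : M 0 0 + M 1 1 = 0) : M ∈ sl (Fin 2) k := by
    change M ∈ LinearMap.ker (Matrix.traceLinearMap (Fin 2) k k)
    simpa [Matrix.trace_fin_two] using h
  have hA : A.1 0 0 + A.1 1 1 = 0 := by
    have h : A.1 ∈ LinearMap.ker (Matrix.traceLinearMap (Fin 2) k k) := A.2
    simpa [Matrix.trace_fin_two] using h
  have h2 : (2 : k) ≠ 0 := NeZero.ne 2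
  refine ⟨⟨!![1, 0; 0, -1], mem (by simp)⟩, ⟨!![0, A.1 0 1 / 2; -A.1 1 0 / 2, 0], mem (by simp)⟩,
    ⟨!![0, 1; 0, 0], mem (by simp)⟩, ⟨!![0, 0; A.1 0 0, 0], mem (by simp)⟩, ?_⟩
  apply Subtype.ext
  change A.1 = ⁅_, _⁆ + ⁅_, _⁆
  ext i j
  fin_cases i <;> fin_cases j <;> simp [Ring.lie_def] <;> grind

open LieAlgebra.SpecialLinear in
theorem three_le_finrank_sl_two (k : Type*) [Field k] : 3 ≤ Module.finrank k (sl (Fin 2) k) := by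
  have h := LinearMap.finrank_range_add_finrank_ker (Matrix.traceLinearMap (Fin 2) k k)
  have h1 := Submodule.finrank_le (LinearMap.range (Matrix.traceLinearMap (Fin 2) k k))
  rw [Module.finrank_self] at h1
  rw [Module.finrank_matrix, Module.finrank_self] at h
  simp only [Fintype.card_fin] at h
  have h3 : Module.finrank k (sl (Fin 2) k) =
    Module.finrank k (LinearMap.ker (Matrix.traceLinearMap (Fin 2) k k)) := rfl
  omega

/-- Let `L` be a finite dimensional simple (right) Leibniz algebra over an
algebraically closed field `k` of characteristic `0` whose Lie factor `L/L^ann` is isomorphic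
to `sl₂(k)` (encoded by a bracket-compatible surjection `π : L → sl₂(k)` with kernel `L^ann`).
Then `dim L ≥ 5`, and if `dim L` is even then `dim L ≥ 6`. -/
theorem simple_leibniz_sl2_dim_bounds
    (k : Type*) [Field k] [IsAlgClosed k] [CharZero k]
    (L : Type*) [AddCommGroup L] [Module k L] [FiniteDimensional k L]
    (br : L →ₗ[k] L →ₗ[k] L)
    (hleib : ∀ x y z : L, br (br x y) z = br x (br y z) + br (br x z) y)
    (ann : Submodule k L)
    (hann : ann = Submodule.span k {z : L | ∃ x : L, z = br x x})
    -- `L` is simple: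
    (hsimple₁ : ∃ a ∈ ann, ∃ x : L, br a x ≠ 0)
    (hsimple₂ : ∀ I : Submodule k L, (∀ a ∈ I, ∀ x : L, br a x ∈ I ∧ br x a ∈ I) →
      I = ⊥ ∨ I = ann ∨ I = ⊤)
    -- the Lie factor `L/L^ann` is isomorphic to `sl₂(k)`:
    (π : L →ₗ[k] (LieAlgebra.SpecialLinear.sl (Fin 2) k))
    (hπsurj : Function.Surjective π)
    (hπbr : ∀ x y : L, π (br x y) = ⁅π x, π y⁆)
    (hπker : LinearMap.ker π = ann) :
    5 ≤ Module.finrank k L ∧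
    (Even (Module.finrank k L) → 6 ≤ Module.finrank k L) := by
  suffices h : 5 ≤ Module.finrank k L from ⟨h, fun ⟨n, hn⟩ => by omega⟩
  have hbr_ann : ∀ x, ∀ a ∈ ann, br x a = 0 := by
    intro x
    suffices h : ann ≤ LinearMap.ker (br x) from fun a ha => h ha
    rw [hann, Submodule.span_le]
    rintro _ ⟨y, rfl⟩
    simpa using hleib x y y
  have hann_br : ∀ a ∈ ann, ∀ x, br a x ∈ ann := by
    intro a ha x
    rw [← hπker, LinearMap.mem_ker] at ha ⊢
    rw [hπbr, ha, zero_lie]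
  have hrank := LinearMap.finrank_range_add_finrank_ker π
  rw [LinearMap.range_eq_top.mpr hπsurj, finrank_top, hπker] at hrank
  have hsl := three_le_finrank_sl_two k
  by_contra hlt
  obtain ⟨v, hv⟩ := finrank_le_one_iff.mp (show Module.finrank k ann ≤ 1 by omega)
  have hscalar : ∀ x, ∃ c : k, ∀ a ∈ ann, br a x = c • a := by
    intro x
    obtain ⟨c, hc⟩ := hv ⟨br v x, hann_br v v.2 x⟩
    refine ⟨c, fun a ha => ?_⟩
    obtain ⟨d, hd⟩ := hv ⟨a, ha⟩
    have hc' : c • (v : L) = br v x := congrArg Subtype.val hc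
    have hd' : d • (v : L) = a := congrArg Subtype.val hd
    rw [← hd', map_smul, LinearMap.smul_apply, ← hc', smul_comm]
  have hcomm : ∀ a ∈ ann, ∀ x y, br a (br x y) = 0 := by
    intro a ha x y
    obtain ⟨c, hc⟩ := hscalar x
    obtain ⟨d, hd⟩ := hscalar y
    have h := hleib a x y
    rw [hc a ha, hd a ha, map_smul, map_smul, LinearMap.smul_apply, LinearMap.smul_apply,
      hc a ha, hd a ha, smul_comm d c] at h
    simpa using h
  obtain ⟨a, ha, x, hx⟩ := hsimple₁
  obtain ⟨B, C, D, E, hBCDE⟩ := sl_two_eq_lie_add_lie (π x)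
  obtain ⟨b, rfl⟩ := hπsurj B
  obtain ⟨c, rfl⟩ := hπsurj C
  obtain ⟨d, rfl⟩ := hπsurj D
  obtain ⟨e, rfl⟩ := hπsurj E
  have hmem : x - (br b c + br d e) ∈ ann := by
    rw [← hπker, LinearMap.mem_ker, map_sub, map_add, hπbr, hπbr, hBCDE, sub_self]
  have h := hbr_ann a _ hmem
  rw [map_sub, map_add, hcomm a ha, hcomm a ha, add_zero, sub_zero] at h
  exact hx h
end
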